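/- Addition Principle: Let A be a commutative Noetherian ring and let I, J be comaximal ideals of A (I + J = A). Let P = Q ⊕ A be a finitely generated projective A-module of constant rank n (having a free direct summand) with n + ht(I ∩ J) ≥ dim A + 3. Suppose Φ, Ψ : P → A are A-linear maps with Φ(P) = I and Ψ(P) = J. Then there exists an A-linear map Δ : P → A with Δ(P) = I ∩ J, Δ(p) − Φ(p) ∈ I² for all p ∈ P, and Δ(p) − Ψ(p) ∈ J² for all p ∈ P. -/

import Mathlib

/-- The height of an ideal: the infimum of the heights of the primes containing it. -/
noncomputable def idealHeight {A : Type*} [CommRing A] (I : Ideal A) : ℕ∞ :=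
  ⨅ (p : PrimeSpectrum A) (_ : I ≤ p.asIdeal), Order.height p

section

open Module

theorem exists_rows_li {k : Type*} [Field k] {m N : ℕ} (M : Matrix (Fin m) (Fin N) k) (s : ℕ)
    (hs : s ≤ M.rank) : ∃ f : Fin s → Fin m, LinearIndependent k (M.submatrix f id).row := by
  obtain ⟨κ, a, ha, hsp, hli⟩ := exists_linearIndependent' k M.row
  have : Finite κ := Finite.of_injective a ha
  cases nonempty_fintype κ
  have hc : Fintype.card κ = M.rank := by
    rw [M.rank_eq_finrank_span_row, ← hsp, finrank_span_eq_card hli]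
  let e : Fin s ↪ κ := (Fin.castLEEmb (hs.trans hc.ge)).trans (Fintype.equivFin κ).symm.toEmbedding
  exact ⟨a ∘ e, hli.comp e e.injective⟩

theorem le_rank_iff_minor {k : Type*} [Field k] {m N : ℕ} (M : Matrix (Fin m) (Fin N) k) (s : ℕ) :
    s ≤ M.rank ↔ ∃ (f : Fin s → Fin m) (g : Fin s → Fin N), (M.submatrix f g).det ≠ 0 := by
  constructor
  · intro hs
    obtain ⟨f, hf⟩ := exists_rows_li M s hs
    have h1 : s ≤ (M.submatrix f id).transpose.rank := by
      rw [Matrix.rank_transpose, hf.rank_matrix, Fintype.card_fin]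
    obtain ⟨g, hg⟩ := exists_rows_li _ s h1
    refine ⟨f, g, ?_⟩
    have := (Matrix.linearIndependent_rows_iff_isUnit.1 hg)
    rw [Matrix.isUnit_iff_isUnit_det] at this
    rw [← Matrix.det_transpose]
    exact this.ne_zero
  · rintro ⟨f, g, h⟩
    have h2 : IsUnit (M.submatrix f g) := by
      rw [Matrix.isUnit_iff_isUnit_det]; exact h.isUnit
    have := (Matrix.linearIndependent_rows_iff_isUnit.2 h2).rank_matrix
    rw [Fintype.card_fin] at this
    rw [← this]
    exact Matrix.rank_submatrix_le _ _ _

/-- rank of a matrix at a prime -/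
noncomputable def rk {B : Type*} [CommRing B] {m N : ℕ} (M : Matrix (Fin m) (Fin N) B)
    (p : PrimeSpectrum B) : ℕ :=
  (M.map (algebraMap B p.asIdeal.ResidueField)).rank

/-- ideal of minors -/
def minorIdeal {B : Type*} [CommRing B] {m N : ℕ} (M : Matrix (Fin m) (Fin N) B) (s : ℕ) :
    Ideal B :=
  Ideal.span {x | ∃ (f : Fin s → Fin m) (g : Fin s → Fin N), (M.submatrix f g).det = x}

theorem rk_lt_iff {B : Type*} [CommRing B] {m N : ℕ} (M : Matrix (Fin m) (Fin N) B)
    (p : PrimeSpectrum B) (s : ℕ) : rk M p < s ↔ minorIdeal M s ≤ p.asIdeal := by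
  rw [← not_le, rk, le_rank_iff_minor, minorIdeal, Ideal.span_le]
  have key : ∀ (f : Fin s → Fin m) (g : Fin s → Fin N),
      (((M.map (algebraMap B p.asIdeal.ResidueField)).submatrix f g).det = 0) ↔
        (M.submatrix f g).det ∈ p.asIdeal := by
    intro f g
    rw [← Ideal.algebraMap_residueField_eq_zero, RingHom.map_det]
    rfl
  constructor
  · rintro h _ ⟨f, g, rfl⟩
    by_contra hc
    exact h ⟨f, g, fun h0 => hc ((key f g).1 h0)⟩
  · rintro h ⟨f, g, h0⟩
    exact h0 ((key f g).2 (h ⟨f, g, rfl⟩))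

theorem affine_avoid {B : Type*} [CommRing B] {u : ℕ} (S : Finset (PrimeSpectrum B))
    (c : (p : PrimeSpectrum B) → Fin u → p.asIdeal.ResidueField)
    (e : (p : PrimeSpectrum B) → p.asIdeal.ResidueField)
    (h : ∀ p ∈ S, (∃ i, c p i ≠ 0) ∨ e p ≠ 0) :
    ∃ a : Fin u → B, ∀ p ∈ S, (∑ i, c p i * algebraMap B _ (a i)) - e p ≠ 0 := by
  classical
  induction hn : S.card generalizing S with
  | zero => exact ⟨0, by simp [Finset.card_eq_zero.1 hn]⟩
  | succ n ih =>
    have hne : S.Nonempty := by rw [← Finset.card_pos]; omega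
    obtain ⟨p, hp⟩ := S.exists_minimal hne
    obtain ⟨a, ha⟩ := ih (S.erase p) (fun q hq => h q (Finset.mem_of_mem_erase hq))
      (by rw [Finset.card_erase_of_mem hp.1]; omega)
    by_cases hap : (∑ i, c p i * algebraMap B _ (a i)) - e p = 0
    swap
    · refine ⟨a, fun q hq => ?_⟩
      by_cases hqp : q = p
      · subst hqp; exact hap
      · exact ha q (Finset.mem_erase.2 ⟨hqp, hq⟩)
    have hi : ∃ i, c p i ≠ 0 := by
      rcases h p hp.1 with h1 | h1
      · exact h1
      · by_contra hcon
        push Not at hcon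
        refine h1 ?_
        simpa [hcon] using hap
    obtain ⟨i, hi⟩ := hi
    have hs : ∃ s, (∀ q ∈ S.erase p, s ∈ q.asIdeal) ∧ s ∉ p.asIdeal := by
      have h1 : ∀ q ∈ S.erase p, ∃ s ∈ q.asIdeal, s ∉ p.asIdeal := by
        intro q hq
        rw [Finset.mem_erase] at hq
        by_contra hcon
        push Not at hcon
        have hle : q ≤ p := hcon
        exact hq.1 (le_antisymm hle (hp.2 hq.2 hle))
      choose! s hs1 hs2 using h1
      refine ⟨∏ q ∈ S.erase p, s q, fun q hq => ?_, ?_⟩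
      · exact Ideal.mem_of_dvd _ (Finset.dvd_prod_of_mem s hq) (hs1 q hq)
      · rw [Ideal.IsPrime.prod_mem_iff]
        push Not
        exact hs2
    obtain ⟨s, hs1, hs2⟩ := hs
    have hsum : ∀ q : PrimeSpectrum B,
        (∑ j, c q j * algebraMap B _ ((a + Pi.single i s : Fin u → B) j)) - e q =
        ((∑ j, c q j * algebraMap B _ (a j)) - e q) + c q i * algebraMap B _ s := by
      intro q
      simp only [Pi.add_apply, map_add, mul_add, Finset.sum_add_distrib]
      rw [Finset.sum_eq_single i
        (f := fun j => c q j * algebraMap B _ ((Pi.single i s : Fin u → B) j))]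
      · simp; ring
      · intro j _ hj; simp [hj]
      · simp
    refine ⟨a + Pi.single i s, fun q hq => ?_⟩
    rw [hsum]
    by_cases hqp : q = p
    · subst hqp
      rw [hap, zero_add]
      exact mul_ne_zero hi (fun h0 => hs2 (Ideal.algebraMap_residueField_eq_zero.1 h0))
    · have hq' := Finset.mem_erase.2 ⟨hqp, hq⟩
      rw [Ideal.algebraMap_residueField_eq_zero.2 (hs1 q hq'), mul_zero, add_zero]
      exact ha q hq'

theorem span_le_of_rel {k V : Type*} [Field k] [AddCommGroup V] [Module k V] {u : ℕ}
    (w : Fin (u + 1) → V) (c : Fin (u + 1) → k) (hc : ∑ i, c i • w i = 0) (γ : Fin u → k)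
    (hγ : (∑ i, c (Fin.castSucc i) * γ i) - c (Fin.last u) ≠ 0) :
    Submodule.span k (Set.range w) ≤
      Submodule.span k (Set.range fun i : Fin u => w i.castSucc + γ i • w (Fin.last u)) := by
  set W := Submodule.span k (Set.range fun i : Fin u => w i.castSucc + γ i • w (Fin.last u))
    with hW
  have h1 : ∀ i : Fin u, w i.castSucc + γ i • w (Fin.last u) ∈ W :=
    fun i => Submodule.subset_span ⟨i, rfl⟩
  have hl : w (Fin.last u) ∈ W := by
    rw [← Submodule.smul_mem_iff W hγ]
    have h2 : ∑ i : Fin u, c i.castSucc • (w i.castSucc + γ i • w (Fin.last u)) ∈ W :=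
      sum_mem fun i _ => W.smul_mem _ (h1 i)
    convert h2 using 1
    rw [Fin.sum_univ_castSucc] at hc
    simp only [smul_add, Finset.sum_add_distrib, sub_smul, Finset.sum_smul, smul_smul]
    rw [eq_neg_of_add_eq_zero_left hc]
    abel
  rw [Submodule.span_le]
  rintro _ ⟨i, rfl⟩
  refine Fin.lastCases hl (fun j => ?_) i
  have := W.sub_mem (h1 j) (W.smul_mem (γ j) hl)
  simpa using this

/-- the elementary row operation -/
def redRows {B : Type*} [CommRing B] {u N : ℕ} (M : Matrix (Fin (u + 1)) (Fin N) B)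
    (b : B) (a : Fin u → B) : Matrix (Fin u) (Fin N) B :=
  fun i j => M i.castSucc j + b * a i * M (Fin.last u) j

theorem redRows_map_row {B : Type*} [CommRing B] {u N : ℕ} (M : Matrix (Fin (u + 1)) (Fin N) B)
    (b : B) (a : Fin u → B) (k : Type*) [Field k] [Algebra B k] :
    ((redRows M b a).map (algebraMap B k)).row =
      fun i : Fin u => (M.map (algebraMap B k)).row i.castSucc +
        (algebraMap B k b * algebraMap B k (a i)) • (M.map (algebraMap B k)).row (Fin.last u) := by
  ext i j
  simp [redRows]

theorem rk_le_redRows_add_one {B : Type*} [CommRing B] {u N : ℕ}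
    (M : Matrix (Fin (u + 1)) (Fin N) B) (b : B) (a : Fin u → B) (p : PrimeSpectrum B) :
    rk M p ≤ rk (redRows M b a) p + 1 := by
  rw [rk, rk, Matrix.rank_eq_finrank_span_row, Matrix.rank_eq_finrank_span_row, redRows_map_row]
  set k := p.asIdeal.ResidueField
  set w := (M.map (algebraMap B k)).row
  set w' := fun i : Fin u => w i.castSucc +
        (algebraMap B k b * algebraMap B k (a i)) • w (Fin.last u)
  have h1 : Submodule.span k (Set.range w) ≤
      Submodule.span k (Set.range w') ⊔ Submodule.span k {w (Fin.last u)} := by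
    rw [Submodule.span_le]
    rintro _ ⟨i, rfl⟩
    have hl : w (Fin.last u) ∈ Submodule.span k (Set.range w') ⊔ Submodule.span k {w (Fin.last u)} :=
      Submodule.mem_sup_right (Submodule.mem_span_singleton_self _)
    refine Fin.lastCases hl (fun j => ?_) i
    have h2 : w' j ∈ Submodule.span k (Set.range w') ⊔ Submodule.span k {w (Fin.last u)} :=
      Submodule.mem_sup_left (Submodule.subset_span ⟨j, rfl⟩)
    have := Submodule.sub_mem _ h2 (Submodule.smul_mem _
      (algebraMap B k b * algebraMap B k (a j)) hl)
    simpa [w'] using this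
  refine (Submodule.finrank_mono h1).trans ((Submodule.finrank_add_le_finrank_add_finrank _ _).trans
    ?_)
  gcongr
  exact (finrank_span_le_card _).trans (by simp)

theorem exists_redRows {B : Type*} [CommRing B] {u N : ℕ}
    (M : Matrix (Fin (u + 1)) (Fin N) B) (b : B) (S : Finset (PrimeSpectrum B))
    (hS : ∀ p ∈ S, b ∉ p.asIdeal ∧ rk M p ≤ u) :
    ∃ a : Fin u → B, ∀ p ∈ S, rk M p ≤ rk (redRows M b a) p := by
  have h1 : ∀ p : PrimeSpectrum B, ∃ c : Fin (u + 1) → p.asIdeal.ResidueField, p ∈ S →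
      ∑ i, c i • (M.map (algebraMap B p.asIdeal.ResidueField)).row i = 0 ∧ ∃ i, c i ≠ 0 := by
    intro p
    by_cases hp : p ∈ S
    swap
    · exact ⟨0, fun h => absurd h hp⟩
    have : ¬ LinearIndependent p.asIdeal.ResidueField
        (M.map (algebraMap B p.asIdeal.ResidueField)).row := by
      intro hli
      have h2 := hli.rank_matrix
      have h3 := (hS p hp).2
      rw [rk, h2, Fintype.card_fin] at h3
      omega
    rw [Fintype.not_linearIndependent_iff] at this
    obtain ⟨c, hc⟩ := this
    exact ⟨c, fun _ => hc⟩
  choose c hc using h1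
  obtain ⟨a, ha⟩ := affine_avoid S (fun p i => c p i.castSucc * algebraMap B _ b)
    (fun p => c p (Fin.last u)) (by
      intro p hp
      obtain ⟨i, hi⟩ := (hc p hp).2
      revert hi
      refine Fin.lastCases (fun h => Or.inr h) (fun j hj => Or.inl ⟨j, ?_⟩) i
      exact mul_ne_zero hj (fun h0 => (hS p hp).1 (Ideal.algebraMap_residueField_eq_zero.1 h0)))
  refine ⟨a, fun p hp => ?_⟩
  rw [rk, rk, Matrix.rank_eq_finrank_span_row, Matrix.rank_eq_finrank_span_row, redRows_map_row]
  refine Submodule.finrank_mono (span_le_of_rel _ (c p) (hc p hp).1 _ ?_)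
  simpa only [mul_assoc] using ha p hp

/-- Matrix form of Eisenbud and Evans. -/
theorem ee_matrix {B : Type*} [CommRing B] [IsNoetherianRing B] {N : ℕ} (r : ℕ) (b : B) (u : ℕ)
    (M : Matrix (Fin (u + 1)) (Fin N) B)
    (hM : ∀ p : PrimeSpectrum B, b ∉ p.asIdeal →
      u + 1 ≤ rk M p ∨ (r : ℕ∞) ≤ rk M p + Order.height p) :
    ∃ a : Fin u → B, ∀ p : PrimeSpectrum B, b ∉ p.asIdeal → Order.height p < r →
      ∃ j, M 0 j + b * ∑ i, a i * M i.succ j ∉ p.asIdeal := by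
  induction u with
  | zero =>
    refine ⟨0, fun p hb hp => ?_⟩
    have h1 : 0 < rk M p := by
      rcases hM p hb with h | h
      · omega
      · by_contra h0
        have : rk M p = 0 := by omega
        rw [this] at h
        simp at h
        exact absurd hp (not_lt.2 h)
    by_contra hcon
    push Not at hcon
    have : M.map (algebraMap B p.asIdeal.ResidueField) = 0 := by
      ext i j
      have hi : i = 0 := Fin.fin_one_eq_zero i
      subst hi
      simpa [Ideal.algebraMap_residueField_eq_zero] using hcon j
    rw [rk, this, Matrix.rank_zero] at h1
    omega
  | succ u ih =>
    set S : Set (PrimeSpectrum B) := {p | b ∉ p.asIdeal ∧ rk M p ≤ u + 1 ∧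
      (r : ℕ∞) = rk M p + Order.height p} with hSdef
    have hfin : S.Finite := by
      have hU : (⋃ t ∈ Set.Iic (u + 2), (PrimeSpectrum.asIdeal ⁻¹' (minorIdeal M t).minimalPrimes)
          : Set (PrimeSpectrum B)).Finite := by
        refine Set.Finite.biUnion (Set.finite_Iic _) (fun t _ => ?_)
        refine Set.Finite.preimage ?_ (Ideal.finite_minimalPrimes_of_isNoetherianRing B _)
        intro x _ y _ h
        exact PrimeSpectrum.ext h
      refine hU.subset ?_
      rintro p ⟨hb, h1, h2⟩
      simp only [Set.mem_iUnion]
      refine ⟨rk M p + 1, by simp; omega, ⟨p.isPrime, (rk_lt_iff M p _).1 (Nat.lt_succ_self _)⟩, ?_⟩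
      rintro q ⟨hq, hle⟩ hqp
      set q' : PrimeSpectrum B := ⟨q, hq⟩
      have h3 : rk M q' < rk M p + 1 := (rk_lt_iff M q' _).2 hle
      have h4 : b ∉ q'.asIdeal := fun h => hb (hqp h)
      have h5 : (r : ℕ∞) ≤ rk M q' + Order.height q' := by
        rcases hM q' h4 with h | h
        · omega
        · exact h
      have hqp' : q' ≤ p := hqp
      rcases hqp'.eq_or_lt with h | h
      · rw [← h]
      · exfalso
        have h6 := Order.height_add_one_le h
        have h7 : (rk M q' : ℕ∞) ≤ rk M p := by exact_mod_cast Nat.lt_succ_iff.1 h3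
        have h8 : (r : ℕ∞) + 1 ≤ r := by
          calc (r : ℕ∞) + 1 ≤ (rk M q' + Order.height q') + 1 := by gcongr
            _ = rk M q' + (Order.height q' + 1) := by rw [add_assoc]
            _ ≤ rk M p + Order.height p := by gcongr
            _ = r := h2.symm
        have h9 : r + 1 ≤ r := by exact_mod_cast h8
        omega
    obtain ⟨a, ha⟩ := exists_redRows M b hfin.toFinset (by
      intro p hp
      rw [Set.Finite.mem_toFinset] at hp
      exact ⟨hp.1, hp.2.1⟩)
    obtain ⟨a', ha'⟩ := ih (redRows M b a) (by
      intro p hb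
      have h1 := rk_le_redRows_add_one M b a p
      by_cases hpS : p ∈ S
      · right
        have h2 := ha p (hfin.mem_toFinset.2 hpS)
        rw [hpS.2.2]
        gcongr
      · by_cases h3 : rk M p ≤ u + 1
        · right
          have h4 : (r : ℕ∞) ≤ rk M p + Order.height p := by
            rcases hM p hb with h | h
            · omega
            · exact h
          have h5 : (r : ℕ∞) ≠ rk M p + Order.height p := fun h => hpS ⟨hb, h3, h⟩
          have h6 := Order.add_one_le_of_lt (lt_of_le_of_ne h4 h5)
          have h7 : (rk M p : ℕ∞) ≤ rk (redRows M b a) p + 1 := by exact_mod_cast h1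
          have h8 : (r : ℕ∞) + 1 ≤ (rk (redRows M b a) p + Order.height p) + 1 := by
            refine h6.trans ?_
            calc (rk M p : ℕ∞) + Order.height p ≤ (rk (redRows M b a) p + 1) + Order.height p := by
                  gcongr
              _ = _ := add_right_comm _ _ _
          exact (ENat.add_le_add_iff_right (by simp)).1 h8
        · left; omega)
    refine ⟨Fin.snoc (α := fun _ => B) a' (a 0 + b * ∑ i, a' i * a i.succ), fun p hb hp => ?_⟩
    obtain ⟨j, hj⟩ := ha' p hb hp
    refine ⟨j, ?_⟩
    convert hj using 2
    rw [Fin.sum_univ_castSucc]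
    simp only [Fin.snoc_castSucc, Fin.snoc_last, redRows, Fin.succ_castSucc, Fin.succ_last,
      Fin.castSucc_zero]
    simp only [mul_add, Finset.sum_add_distrib, add_mul, Finset.mul_sum, Finset.sum_mul]
    have : ∀ i : Fin u, b * (a' i * (b * a i.succ * M (Fin.last (u + 1)) j)) =
      b * (b * (a' i * a i.succ) * M (Fin.last (u + 1)) j) := fun i => by ring
    simp only [this]
    ring

open TensorProduct in
theorem rank_idem {A : Type*} [CommRing A] {Q : Type*} [AddCommGroup Q] [Module A Q]
    [Module.Finite A Q] [Module.Projective A Q] {N : ℕ} (f : (Fin N → A) →ₗ[A] Q)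
    (g : Q →ₗ[A] (Fin N → A)) (hfg : f ∘ₗ g = LinearMap.id) (k : Type*) [Field k] [Algebra A k] :
    ∃ p, ((LinearMap.toMatrix' (g ∘ₗ f)).map (algebraMap A k)).rank =
      Module.rankAtStalk (R := A) Q p := by
  let p0 : PrimeSpectrum k := ⟨⊥, Ideal.isPrime_bot⟩
  refine ⟨p0.comap (algebraMap A k), ?_⟩
  rw [← Module.rankAtStalk_baseChange (S := k), Module.rankAtStalk_eq_finrank_of_free]
  have h1 : (f.baseChange k) ∘ₗ (g.baseChange k) = LinearMap.id := by
    rw [← LinearMap.baseChange_comp, hfg, LinearMap.baseChange_id]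
  have hinj : Function.Injective (g.baseChange k) :=
    Function.LeftInverse.injective (g := f.baseChange k) (fun x => LinearMap.congr_fun h1 x)
  have hsurj : Function.Surjective (f.baseChange k) :=
    fun x => ⟨_, LinearMap.congr_fun h1 x⟩
  have h2 : Module.finrank k (LinearMap.range ((g ∘ₗ f).baseChange k)) =
      Module.finrank k (k ⊗[A] Q) := by
    rw [LinearMap.baseChange_comp, LinearMap.range_comp, LinearMap.range_eq_top.2 hsurj,
      Submodule.map_top, LinearMap.finrank_range_of_inj hinj]
  have h3 := LinearMap.toMatrix_baseChange (A := k) (g ∘ₗ f) (Pi.basisFun A (Fin N))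
    (Pi.basisFun A (Fin N))
  rw [LinearMap.toMatrix_eq_toMatrix'] at h3
  rw [← h3, Matrix.rank_eq_finrank_range_toLin _ (Algebra.TensorProduct.basis k (Pi.basisFun A (Fin N)))
    (Algebra.TensorProduct.basis k (Pi.basisFun A (Fin N))), Matrix.toLin_toMatrix, h2]
  rfl

/-- Eisenbud and Evans for projective modules. -/
theorem ee_proj {A : Type*} [CommRing A] [IsNoetherianRing A] {Q : Type*} [AddCommGroup Q]
    [Module A Q] [Module.Finite A Q] [Module.Projective A Q] (r : ℕ)
    (hr : ∀ p, r ≤ Module.rankAtStalk (R := A) Q p) (K : Ideal A) (ψ : Q →ₗ[A] A) (b : A) :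
    ∃ β : Q →ₗ[A] A, ∀ p : PrimeSpectrum (A ⧸ K), Ideal.Quotient.mk K b ∉ p.asIdeal →
      (∀ q, Ideal.Quotient.mk K (ψ q + b * β q) ∈ p.asIdeal) → (r : ℕ∞) ≤ Order.height p := by
  obtain ⟨N, f, hf⟩ := Module.Finite.exists_fin' A Q
  obtain ⟨g, hfg⟩ := Module.projective_lifting_property f LinearMap.id hf
  let E : Matrix (Fin N) (Fin N) A := LinearMap.toMatrix' (g ∘ₗ f)
  let M : Matrix (Fin (N + 1)) (Fin N) (A ⧸ K) := fun i j =>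
    Fin.cases (Ideal.Quotient.mk K (ψ (f (Pi.single j 1))))
      (fun i => Ideal.Quotient.mk K (E i j)) i
  obtain ⟨a, ha⟩ := ee_matrix r (Ideal.Quotient.mk K b) N M (by
    intro p _
    right
    have h1 : r ≤ rk M p := by
      let : Algebra A p.asIdeal.ResidueField :=
        ((algebraMap (A ⧸ K) p.asIdeal.ResidueField).comp (Ideal.Quotient.mk K)).toAlgebra
      obtain ⟨p', hp'⟩ := rank_idem f g hfg p.asIdeal.ResidueField
      refine (hr p').trans (hp'.symm.le.trans ?_)
      exact Matrix.rank_submatrix_le (M.map (algebraMap (A ⧸ K) p.asIdeal.ResidueField))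
        Fin.succ id
    have h2 : (r : ℕ∞) ≤ rk M p := by exact_mod_cast h1
    exact h2.trans le_self_add)
  choose a' ha' using fun i => Ideal.Quotient.mk_surjective (a i)
  refine ⟨∑ i, a' i • (LinearMap.proj i ∘ₗ g), fun p hb hall => ?_⟩
  by_contra hlt
  obtain ⟨j, hj⟩ := ha p hb (not_le.1 hlt)
  apply hj
  convert hall (f (Pi.single j 1)) using 1
  simp [M, E, ← ha', LinearMap.toMatrix'_apply]

theorem height_quot {A : Type*} [CommRing A] (K : Ideal A) (c : ℕ∞)
    (hc : ∀ p : PrimeSpectrum A, K ≤ p.asIdeal → c ≤ Order.height p) (r : ℕ)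
    (P : PrimeSpectrum (A ⧸ K)) (hP : (r : ℕ∞) ≤ Order.height P) :
    (r : ℕ∞) + c ≤ Order.height (P.comap (Ideal.Quotient.mk K)) := by
  induction r generalizing P with
  | zero =>
    simp only [Nat.cast_zero, zero_add]
    apply hc
    intro x hx
    simp [PrimeSpectrum.comap_asIdeal, Ideal.Quotient.eq_zero_iff_mem.2 hx]
  | succ r ih =>
    obtain ⟨s, hs, hl⟩ := Order.exists_series_of_le_height P hP
    have hne : s.length ≠ 0 := by omega
    have h1 : s.eraseLast.last < s.last := by
      have := s.eraseLast_last_rel_last hne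
      exact this
    have h2 := ih s.eraseLast.last (by
      have := Order.length_le_height_last (p := s.eraseLast)
      simpa [hl] using this)
    have h3 : (s.eraseLast.last).comap (Ideal.Quotient.mk K) < P.comap (Ideal.Quotient.mk K) := by
      rw [← hs]
      have hle : (s.eraseLast.last).comap (Ideal.Quotient.mk K) ≤
        s.last.comap (Ideal.Quotient.mk K) := Ideal.comap_mono h1.le
      refine lt_of_le_of_ne hle (fun h => h1.ne ?_)
      exact PrimeSpectrum.comap_injective_of_surjective _ Ideal.Quotient.mk_surjective h
    have h4 := Order.height_add_one_le h3
    refine le_trans ?_ h4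
    push_cast
    rw [add_right_comm]
    gcongr

theorem ee_final {A : Type*} [CommRing A] [IsNoetherianRing A] {Q : Type*} [AddCommGroup Q]
    [Module A Q] [Module.Finite A Q] [Module.Projective A Q] (r : ℕ)
    (hr : ∀ p, r ≤ Module.rankAtStalk (R := A) Q p) (K : Ideal A) (ψ : Q →ₗ[A] A) (b : A) (c : ℕ∞)
    (hc : ∀ p : PrimeSpectrum A, K ≤ p.asIdeal → c ≤ Order.height p) :
    ∃ β : Q →ₗ[A] A, ∀ p : PrimeSpectrum A, K ≤ p.asIdeal → b ∉ p.asIdeal →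
      (∀ q, ψ q + b * β q ∈ p.asIdeal) → (r : ℕ∞) + c ≤ Order.height p := by
  obtain ⟨β, hβ⟩ := ee_proj r hr K ψ b
  refine ⟨β, fun p hK hb h => ?_⟩
  have hmem : p ∈ Set.range (PrimeSpectrum.comap (Ideal.Quotient.mk K)) := by
    rw [range_comap_of_surjective _ _ Ideal.Quotient.mk_surjective]
    simpa [PrimeSpectrum.mem_zeroLocus, Ideal.mk_ker] using hK
  obtain ⟨P, rfl⟩ := hmem
  exact height_quot K c hc r P (hβ P hb h)

theorem uni {A : Type*} [CommRing A] [IsNoetherianRing A] {Q : Type*} [AddCommGroup Q]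
    [Module A Q] [Module.Finite A Q] [Module.Projective A Q] (r : ℕ)
    (hr : ∀ p, r ≤ Module.rankAtStalk (R := A) Q p) (K : Ideal A) (ψ : Q →ₗ[A] A) (b : A) (c : ℕ∞)
    (hc : ∀ p : PrimeSpectrum A, K ≤ p.asIdeal → c ≤ Order.height p)
    (hd : ∀ p : PrimeSpectrum A, Order.height p < r + c)
    (htop : (LinearMap.range ψ ⊔ Ideal.span {b}) ⊔ K = ⊤) :
    ∃ β : Q →ₗ[A] A, LinearMap.range (ψ + b • β) ⊔ K = ⊤ := by
  obtain ⟨β, hβ⟩ := ee_final r hr K ψ b c hc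
  refine ⟨β, ?_⟩
  by_contra hne
  obtain ⟨m, hm, hle⟩ := Ideal.exists_le_maximal _ hne
  have h1 : ∀ q, ψ q + b * β q ∈ m := fun q =>
    hle (Submodule.mem_sup_left ⟨q, by simp⟩)
  have hK : K ≤ m := le_sup_right.trans hle
  by_cases hb : b ∈ m
  · apply hm.ne_top
    rw [eq_top_iff, ← htop]
    refine sup_le (sup_le ?_ ?_) hK
    · rintro _ ⟨q, rfl⟩
      exact (Submodule.add_mem_iff_left m (Ideal.mul_mem_right _ m hb)).1 (h1 q)
    · rwa [Ideal.span_singleton_le_iff_mem]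
  · exact absurd (hβ ⟨m, hm.isPrime⟩ hK hb h1) (not_le.2 (hd _))

open TensorProduct in
theorem krull_le {A : Type*} [CommRing A] [IsNoetherianRing A] {P : Type*} [AddCommGroup P]
    [Module A P] [Module.Finite A P] [Module.Projective A P] (n : ℕ)
    (hr : ∀ p, Module.rankAtStalk (R := A) P p = n) (Φ : P →ₗ[A] A)
    (hne : (LinearMap.range Φ : Ideal A) ≠ ⊤) :
    ∃ p : PrimeSpectrum A, LinearMap.range Φ ≤ p.asIdeal ∧ Order.height p ≤ n := by
  classical
  obtain ⟨p, hp⟩ := Ideal.nonempty_minimalPrimes hne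
  have hpp : p.IsPrime := hp.1.1
  refine ⟨⟨p, hpp⟩, hp.1.2, ?_⟩
  rw [← PrimeSpectrum.height_eq_orderHeight]
  let S := Localization.AtPrime p
  have hfree : Module.Free S (S ⊗[A] P) := Module.free_of_flat_of_isLocalRing
  have hrk : Module.finrank S (S ⊗[A] P) = n := by
    rw [← hr ⟨p, hpp⟩, Module.rankAtStalk_eq_finrank_tensorProduct]
  let bs := Module.finBasisOfFinrankEq S (S ⊗[A] P) hrk
  let Φ' : S ⊗[A] P →ₗ[S] S :=
    (TensorProduct.AlgebraTensorModule.rid A S S).toLinearMap ∘ₗ Φ.baseChange S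
  have hΦ' : ∀ (s : S) (x : P), Φ' (s ⊗ₜ x) = algebraMap A S (Φ x) * s := by
    intro s x
    simp [Φ', Algebra.smul_def]
  let T : Finset S := Finset.univ.image (fun i => Φ' (bs i))
  have hT : Ideal.span (T : Set S) = Ideal.map (algebraMap A S) (LinearMap.range Φ) := by
    apply le_antisymm
    · rw [Ideal.span_le]
      intro y hy
      simp only [T, Finset.coe_image, Finset.coe_univ, Set.image_univ] at hy
      obtain ⟨i, rfl⟩ := hy
      simp only [SetLike.mem_coe]
      induction bs i with
      | zero => simp
      | tmul s x =>
        rw [hΦ']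
        exact Ideal.mul_mem_right _ _ (Ideal.mem_map_of_mem _ ⟨x, rfl⟩)
      | add x y hx hy => rw [map_add]; exact add_mem hx hy
    · rw [Ideal.map_le_iff_le_comap]
      rintro _ ⟨x, rfl⟩
      rw [Ideal.mem_comap]
      have h1 : algebraMap A S (Φ x) = Φ' (1 ⊗ₜ x) := by rw [hΦ', mul_one]
      rw [h1, ← bs.sum_repr (1 ⊗ₜ x), map_sum]
      refine sum_mem fun i _ => ?_
      rw [map_smul]
      exact Ideal.mul_mem_left _ _ (Ideal.subset_span (by simp [T]))
  have hmin : IsLocalRing.maximalIdeal S ∈ (Ideal.span (T : Set S)).minimalPrimes := by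
    rw [hT, IsLocalization.minimalPrimes_map p.primeCompl S, Set.mem_preimage]
    have := IsLocalization.AtPrime.under_maximalIdeal S p
    rwa [this]
  have h1 := Ideal.height_le_card_of_mem_minimalPrimes_span_finset hmin
  have h2 : p.height = (IsLocalRing.maximalIdeal S).height := by
    have h3 := IsLocalization.height_under p.primeCompl (IsLocalRing.maximalIdeal S)
    rwa [IsLocalization.AtPrime.under_maximalIdeal S p] at h3
  rw [h2]
  refine h1.trans ?_
  have : T.card ≤ n := Finset.card_image_le.trans (by simp)
  exact_mod_cast this

theorem core {A : Type*} [CommRing A] [IsNoetherianRing A] {Q : Type*} [AddCommGroup Q]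
    [Module A Q] (φ ψ : Q →ₗ[A] A) (a b : A)
    (hKL : (LinearMap.range φ ⊔ LinearMap.range ψ : Ideal A) = ⊤) :
    ∃ Δ : (Q × A) →ₗ[A] A,
      LinearMap.range Δ = (LinearMap.range φ ⊔ Ideal.span {a}) ⊓
        (LinearMap.range ψ ⊔ Ideal.span {b}) ∧
      (∀ q x, Δ (q, x) - (φ q + a * x) ∈ (LinearMap.range φ ⊔ Ideal.span {a} : Ideal A) ^ 2) ∧
      (∀ q x, Δ (q, x) - (ψ q + b * x) ∈ (LinearMap.range ψ ⊔ Ideal.span {b} : Ideal A) ^ 2) := by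
  set K : Ideal A := LinearMap.range φ with hK
  set L : Ideal A := LinearMap.range ψ with hL
  have hφ : ∀ q, φ q ∈ K := fun q => ⟨q, rfl⟩
  have hψ : ∀ q, ψ q ∈ L := fun q => ⟨q, rfl⟩
  obtain ⟨s, hs, t, ht, hst⟩ : ∃ s ∈ K ^ 2, ∃ t ∈ L ^ 2, s + t = 1 := by
    have h1 : IsCoprime (K ^ 2) (L ^ 2) :=
      (Ideal.isCoprime_iff_sup_eq.2 hKL).pow
    have h2 := Ideal.isCoprime_iff_sup_eq.1 h1
    have h3 : (1 : A) ∈ K ^ 2 ⊔ L ^ 2 := by rw [h2]; trivial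
    exact Submodule.mem_sup.1 h3
  have hsK : s ∈ K := Ideal.pow_le_self two_ne_zero hs
  have htL : t ∈ L := Ideal.pow_le_self two_ne_zero ht
  set H : Ideal A := K ⊓ L with hH
  set c := t * a + s * b with hc
  set δ : Q →ₗ[A] A := t • φ + s • ψ with hδ
  have hδq : ∀ q, δ q = t * φ q + s * ψ q := fun q => by simp [hδ]
  set D : Ideal A := LinearMap.range δ with hD
  have hmemH : ∀ q q', t * φ q + s * ψ q' ∈ H := fun q q' =>
    ⟨add_mem (K.mul_mem_left _ (hφ q)) (K.mul_mem_right _ hsK),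
      add_mem (L.mul_mem_right _ htL) (L.mul_mem_left _ (hψ q'))⟩
  have hDH : D ≤ H := by
    rintro _ ⟨q, rfl⟩
    rw [hδq]; exact hmemH q q
  have htsH : t * s ∈ H := ⟨K.mul_mem_left _ hsK, L.mul_mem_right _ htL⟩
  have htsH2 : t * s ∈ H • H := by
    have h1 : t * s ∈ L ^ 2 * K ^ 2 := Ideal.mul_mem_mul ht hs
    have h2 : L ^ 2 * K ^ 2 ≤ H • H := by
      rw [smul_eq_mul, ← mul_pow, pow_two]
      exact Ideal.mul_mono (Ideal.mul_le_inf.trans_eq (inf_comm _ _)) (Ideal.mul_le_inf.trans_eq (inf_comm _ _))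
    exact h2 h1
  have hle : H ≤ D ⊔ H • H := by
    rintro x ⟨⟨q, hq⟩, ⟨q', hq'⟩⟩
    have h1 : x = δ (t • q + s • q') + t * s * (2 * x - φ q' - ψ q) := by
      rw [hδq]
      simp only [map_add, map_smul, smul_eq_mul, hq, hq']
      have : s = 1 - t := by rw [← hst]; ring
      rw [this]; ring
    rw [h1]
    exact add_mem (Submodule.mem_sup_left ⟨_, rfl⟩)
      (Submodule.mem_sup_right (Ideal.mul_mem_right _ _ htsH2))
  obtain ⟨r, hr1, hr2⟩ := Submodule.exists_sub_one_mem_and_smul_le_of_fg_of_le_sup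
    (IsNoetherian.noetherian H) le_rfl hle
  have hrD : ∀ y ∈ H, r * y ∈ D := fun y hy => hr2 (Submodule.smul_mem_pointwise_smul y r H hy)
  set e := 1 - r with he
  have heH : e ∈ H := by
    have h0 : e = -(r - 1) := by rw [he]; ring
    rw [h0]; exact neg_mem hr1
  set g := c + e ^ 2 * (1 - c) with hg
  set Δ : (Q × A) →ₗ[A] A := δ.coprod (LinearMap.toSpanSingleton A A g) with hΔ
  have hΔq : ∀ q x, Δ (q, x) = t * φ q + s * ψ q + g * x := fun q x => by
    simp [hΔ, hδq, mul_comm]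
  have hHI : H ≤ K ⊔ Ideal.span {a} := inf_le_left.trans le_sup_left
  have hHJ : H ≤ L ⊔ Ideal.span {b} := inf_le_right.trans le_sup_left
  have haI : a ∈ K ⊔ Ideal.span {a} := Submodule.mem_sup_right (Ideal.mem_span_singleton_self a)
  have hbJ : b ∈ L ⊔ Ideal.span {b} := Submodule.mem_sup_right (Ideal.mem_span_singleton_self b)
  have h1I : ∀ q x, Δ (q, x) - (φ q + a * x) ∈ (K ⊔ Ideal.span {a}) ^ 2 := by
    intro q x
    have h1 : Δ (q, x) - (φ q + a * x) = s * (ψ q - φ q + (b - a) * x) + e ^ 2 * ((1 - c) * x) := by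
      rw [hΔq, hg, hc]
      have : t = 1 - s := by rw [← hst]; ring
      rw [this]; ring
    rw [h1]
    exact add_mem (Ideal.mul_mem_right _ _ (Ideal.pow_right_mono le_sup_left 2 hs))
      (Ideal.mul_mem_right _ _ (Ideal.pow_mem_pow (hHI heH) 2))
  have h1J : ∀ q x, Δ (q, x) - (ψ q + b * x) ∈ (L ⊔ Ideal.span {b}) ^ 2 := by
    intro q x
    have h1 : Δ (q, x) - (ψ q + b * x) = t * (φ q - ψ q + (a - b) * x) + e ^ 2 * ((1 - c) * x) := by
      rw [hΔq, hg, hc]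
      have : s = 1 - t := by rw [← hst]; ring
      rw [this]; ring
    rw [h1]
    exact add_mem (Ideal.mul_mem_right _ _ (Ideal.pow_right_mono le_sup_left 2 ht))
      (Ideal.mul_mem_right _ _ (Ideal.pow_mem_pow (hHJ heH) 2))
  refine ⟨Δ, le_antisymm ?_ ?_, h1I, h1J⟩
  · rintro _ ⟨⟨q, x⟩, rfl⟩
    constructor
    · have h2 := Ideal.pow_le_self two_ne_zero (h1I q x)
      exact (Submodule.sub_mem_iff_left _ (add_mem (Submodule.mem_sup_left (hφ q))
        (Ideal.mul_mem_right _ _ haI))).1 h2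
    · have h2 := Ideal.pow_le_self two_ne_zero (h1J q x)
      exact (Submodule.sub_mem_iff_left _ (add_mem (Submodule.mem_sup_left (hψ q))
        (Ideal.mul_mem_right _ _ hbJ))).1 h2
  · set R : Ideal A := LinearMap.range Δ with hR
    have hDR : D ≤ R := by
      rintro _ ⟨q, rfl⟩
      exact ⟨(q, 0), by rw [hΔq, hδq]; ring⟩
    have hgR : g ∈ R := ⟨(0, 1), by rw [hΔq]; simp⟩
    have heR : e ∈ R := by
      have h1 : r * e ∈ R := hDR (hrD e heH)
      have h2 : e = e * g + r * e * ((1 + e) * (1 - c)) := by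
        rw [hg, show r = 1 - e by rw [he]; ring]; ring
      rw [h2]
      exact add_mem (R.mul_mem_left _ hgR) (R.mul_mem_right _ h1)
    have hHR : H ≤ R := by
      intro y hy
      have : y = r * y + e * y := by rw [he]; ring
      rw [this]
      exact add_mem (hDR (hrD y hy)) (R.mul_mem_right _ heR)
    have hcR : c ∈ R := by
      have : c = g - e * (e * (1 - c)) := by rw [hg]; ring
      rw [this]
      exact sub_mem hgR (R.mul_mem_right _ heR)
    rintro y ⟨hy1, hy2⟩
    obtain ⟨_, ⟨q, rfl⟩, _, hx, h1⟩ := Submodule.mem_sup.1 hy1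
    obtain ⟨_, ⟨q', rfl⟩, _, hx', h2⟩ := Submodule.mem_sup.1 hy2
    obtain ⟨x, rfl⟩ := Ideal.mem_span_singleton'.1 hx
    obtain ⟨x', rfl⟩ := Ideal.mem_span_singleton'.1 hx'
    have h3 : y = (t * φ q + s * ψ q') + t * s * ((a - b) * (x - x')) + c * (t * x + s * x') := by
      calc y = t * y + s * y := by rw [← add_mul, add_comm t s, hst, one_mul]
        _ = t * (φ q + x * a) + s * (ψ q' + x' * b) := by rw [h1, h2]
        _ = _ := by
          rw [hc]
          have : s = 1 - t := by rw [← hst]; ring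
          rw [this]; ring
    rw [h3]
    exact add_mem (add_mem (hHR (hmemH q q')) (R.mul_mem_right _ (hHR htsH)))
      (R.mul_mem_right _ hcR)

theorem range_split {A : Type*} [CommRing A] {Q : Type*} [AddCommGroup Q] [Module A Q]
    (Φ : (Q × A) →ₗ[A] A) (α : Q →ₗ[A] A) :
    (LinearMap.range (Φ ∘ₗ LinearMap.inl A Q A + Φ (0, 1) • α) ⊔ Ideal.span {Φ (0, 1)} : Ideal A) =
      LinearMap.range Φ := by
  have key : ∀ q x, Φ (q, x) = Φ (q, 0) + x * Φ (0, 1) := by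
    intro q x
    have : ((q, x) : Q × A) = (q, 0) + x • (0, 1) := by simp
    rw [this, map_add, map_smul, smul_eq_mul]
  apply le_antisymm
  · refine sup_le ?_ ?_
    · rintro _ ⟨q, rfl⟩
      refine ⟨(q, α q), ?_⟩
      rw [key]; simp [mul_comm]
    · rw [Ideal.span_singleton_le_iff_mem]
      exact ⟨_, rfl⟩
  · rintro _ ⟨⟨q, x⟩, rfl⟩
    refine Submodule.mem_sup.2 ⟨_, ⟨q, rfl⟩, (x - α q) * Φ (0, 1),
      Ideal.mul_mem_left _ _ (Ideal.mem_span_singleton_self _), ?_⟩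
    rw [key q x]; simp; ring

theorem twist {A : Type*} [CommRing A] {Q : Type*} [AddCommGroup Q] [Module A Q]
    (Δ : (Q × A) →ₗ[A] A) (γ : Q →ₗ[A] A) :
    ∃ Δ' : (Q × A) →ₗ[A] A, LinearMap.range Δ' = LinearMap.range Δ ∧
      ∀ q x, Δ' (q, x) = Δ (q, x - γ q) := by
  let f : (Q × A) →ₗ[A] (Q × A) :=
    (LinearMap.fst A Q A).prod (LinearMap.snd A Q A - γ ∘ₗ LinearMap.fst A Q A)
  have hf : ∀ q x, f (q, x) = (q, x - γ q) := fun q x => rfl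
  refine ⟨Δ ∘ₗ f, ?_, fun q x => by simp [hf]⟩
  apply LinearMap.range_comp_of_range_eq_top
  rw [LinearMap.range_eq_top]
  rintro ⟨q, x⟩
  exact ⟨(q, x + γ q), by simp [hf]⟩

theorem main_split {A : Type*} [CommRing A] [IsNoetherianRing A]
    {Q : Type*} [AddCommGroup Q] [Module A Q] [Module.Finite A Q] [Module.Projective A Q]
    (r h : ℕ) (hr : ∀ p, Module.rankAtStalk (R := A) Q p = r) (hhr : h ≤ r + 1)
    (I J : Ideal A) (hcomax : I ⊔ J = ⊤)
    (hht : ∀ p : PrimeSpectrum A, I ⊓ J ≤ p.asIdeal → (h : ℕ∞) ≤ Order.height p)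
    (hdim : ∀ p : PrimeSpectrum A, Order.height p + 2 ≤ (r : ℕ∞) + h)
    (Φ Ψ : (Q × A) →ₗ[A] A)
    (hΦ : LinearMap.range Φ = I)
    (hΨ : LinearMap.range Ψ = J) :
    ∃ Δ : (Q × A) →ₗ[A] A,
      LinearMap.range Δ = I ⊓ J ∧
      (∀ p : Q × A, Δ p - Φ p ∈ I ^ 2) ∧
      (∀ p : Q × A, Δ p - Ψ p ∈ J ^ 2) := by
  have hr' : ∀ p, r ≤ Module.rankAtStalk (R := A) Q p := fun p => (hr p).ge
  have hI : ∀ α : Q →ₗ[A] A, (LinearMap.range (Φ ∘ₗ LinearMap.inl A Q A + Φ (0, 1) • α) ⊔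
      Ideal.span {Φ (0, 1)} : Ideal A) = I := fun α => (range_split Φ α).trans hΦ
  have hJ : ∀ α : Q →ₗ[A] A, (LinearMap.range (Ψ ∘ₗ LinearMap.inl A Q A + Ψ (0, 1) • α) ⊔
      Ideal.span {Ψ (0, 1)} : Ideal A) = J := fun α => (range_split Ψ α).trans hΨ
  have keyΦ : ∀ q x, Φ (q, x) = Φ (q, 0) + x * Φ (0, 1) := by
    intro q x
    have : ((q, x) : Q × A) = (q, 0) + x • (0, 1) := by simp
    rw [this, map_add, map_smul, smul_eq_mul]
  have keyΨ : ∀ q x, Ψ (q, x) = Ψ (q, 0) + x * Ψ (0, 1) := by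
    intro q x
    have : ((q, x) : Q × A) = (q, 0) + x • (0, 1) := by simp
    rw [this, map_add, map_smul, smul_eq_mul]
  set a := Φ (0, 1) with ha
  set b := Ψ (0, 1) with hb
  set φ : Q →ₗ[A] A := Φ ∘ₗ LinearMap.inl A Q A with hφ
  set ψ : Q →ₗ[A] A := Ψ ∘ₗ LinearMap.inl A Q A with hψ
  have hfin : ∀ p : PrimeSpectrum A, ∃ k : ℕ, Order.height p = k ∧ k + 2 ≤ r + h := by
    intro p
    have h1 := hdim p
    have h2 : Order.height p ≠ ⊤ := by
      intro h3
      rw [h3, top_add, top_le_iff] at h1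
      exact absurd h1 (by exact_mod_cast ENat.natCast_ne_top (r + h))
    obtain ⟨k, hk⟩ := ENat.ne_top_iff_exists.1 h2
    refine ⟨k, hk.symm, ?_⟩
    rw [← hk] at h1
    exact_mod_cast h1
  have haI : a ∈ I := by rw [← hΦ]; exact ⟨_, rfl⟩
  have hbJ : b ∈ J := by rw [← hΨ]; exact ⟨_, rfl⟩
  obtain ⟨α0, hα0⟩ := uni r hr' J φ a h (fun p hp => hht p (inf_le_right.trans hp))
    (fun p => by
      obtain ⟨k, hk, hk2⟩ := hfin p
      rw [hk]
      have : k < r + h := by omega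
      exact_mod_cast this)
    (by
      have := hI 0
      rw [smul_zero, add_zero] at this
      rw [this, hcomax])
  obtain ⟨_, ⟨q0, rfl⟩, j, hj, hq0⟩ : ∃ y ∈ (LinearMap.range (φ + a • α0) : Ideal A), ∃ j ∈ J,
      y + j = 1 := by
    apply Submodule.mem_sup.1
    rw [hα0]; trivial
  obtain ⟨α1, hα1⟩ := ee_final r hr' ⊥ (φ + a • α0) (a * j) 0 (fun p _ => by simp)
  set α : Q →ₗ[A] A := α0 + j • α1 with hα
  have hφ2 : ∀ q, (φ + a • α) q = (φ + a • α0) q + a * j * α1 q := by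
    intro q
    simp [hα]; ring
  set K : Ideal A := LinearMap.range (φ + a • α) with hK
  have hKJ : K ⊔ J = ⊤ := by
    rw [Ideal.eq_top_iff_one]
    refine Submodule.mem_sup.2 ⟨_, ⟨q0, rfl⟩, j - a * j * α1 q0, ?_, ?_⟩
    · exact sub_mem hj (Ideal.mul_mem_right _ _ (Ideal.mul_mem_left _ _ hj))
    · rw [hφ2, ← hq0]; ring
  have hKht : ∀ p : PrimeSpectrum A, K ≤ p.asIdeal → ((min h r : ℕ) : ℕ∞) ≤ Order.height p := by
    intro p hp
    by_cases hap : a ∈ p.asIdeal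
    · have hIp : I ≤ p.asIdeal := by
        rw [← hI α]
        refine sup_le hp ?_
        rwa [Ideal.span_singleton_le_iff_mem]
      refine le_trans ?_ (hht p (inf_le_left.trans hIp))
      exact_mod_cast min_le_left h r
    · have hmem : ∀ q, (φ + a • α0) q + a * j * α1 q ∈ p.asIdeal := fun q => by
        rw [← hφ2]; exact hp ⟨q, rfl⟩
      have hjp : j ∉ p.asIdeal := by
        intro hjp
        apply p.isPrime.ne_top
        rw [Ideal.eq_top_iff_one, ← hq0]
        refine add_mem ?_ hjp
        exact (Submodule.add_mem_iff_left _ (Ideal.mul_mem_right _ _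
          (Ideal.mul_mem_left _ _ hjp))).1 (hmem q0)
      have h1 := hα1 p bot_le (fun h => (p.isPrime.mem_or_mem h).elim hap hjp) hmem
      rw [add_zero] at h1
      refine le_trans ?_ h1
      exact_mod_cast min_le_right h r
  obtain ⟨β, hβ⟩ := uni r hr' K ψ b _ hKht
    (fun p => by
      obtain ⟨k, hk, hk2⟩ := hfin p
      rw [hk]
      have : k < r + min h r := by omega
      exact_mod_cast this)
    (by
      have := hJ 0
      rw [smul_zero, add_zero] at this
      rw [this, sup_comm, hKJ])
  obtain ⟨Δ', hΔ1, hΔ2, hΔ3⟩ := core (φ + a • α) (ψ + b • β) a b (by rw [sup_comm]; exact hβ)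
  rw [hI α] at hΔ1 hΔ2
  rw [hJ β] at hΔ1 hΔ3
  obtain ⟨i', hi', j', hj', hij⟩ : ∃ i ∈ I, ∃ j ∈ J, i + j = 1 := by
    apply Submodule.mem_sup.1
    rw [hcomax]; trivial
  obtain ⟨Δ, hΔr, hΔ⟩ := twist Δ' (j' • α + i' • β)
  refine ⟨Δ, hΔr.trans hΔ1, ?_, ?_⟩
  · rintro ⟨q, x⟩
    have h1 := hΔ2 q (x - (j' • α + i' • β) q)
    have h2 : Δ (q, x) - Φ (q, x) = (Δ' (q, x - (j' • α + i' • β) q) -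
        ((φ + a • α) q + a * (x - (j' • α + i' • β) q))) + a * i' * (α q - β q) := by
      rw [hΔ, keyΦ]
      have : j' = 1 - i' := by rw [← hij]; ring
      simp [hφ, this]; ring
    rw [h2]
    refine add_mem h1 (Ideal.mul_mem_right _ _ ?_)
    rw [pow_two]
    exact Ideal.mul_mem_mul haI hi'
  · rintro ⟨q, x⟩
    have h1 := hΔ3 q (x - (j' • α + i' • β) q)
    have h2 : Δ (q, x) - Ψ (q, x) = (Δ' (q, x - (j' • α + i' • β) q) -
        ((ψ + b • β) q + b * (x - (j' • α + i' • β) q))) + b * j' * (β q - α q) := by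
      rw [hΔ, keyΨ]
      have : i' = 1 - j' := by rw [← hij]; ring
      simp [hψ, this]; ring
    rw [h2]
    refine add_mem h1 (Ideal.mul_mem_right _ _ ?_)
    rw [pow_two]
    exact Ideal.mul_mem_mul hbJ hj'

end

/-- **Addition Principle.**  Let `A` be a commutative Noetherian ring, `I, J` comaximal
ideals, and `P = Q ⊕ A` a finitely generated projective `A`-module of constant rank `n`
with `n + ht (I ∩ J) ≥ dim A + 3`.  If `Φ, Ψ : P → A` are linear maps with `Φ(P) = I` and
`Ψ(P) = J`, then there is a linear map `Δ : P → A` with `Δ(P) = I ∩ J`, `Δ ≡ Φ mod I²`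
and `Δ ≡ Ψ mod J²`. -/
theorem addition_principle {A : Type*} [CommRing A] [IsNoetherianRing A]
    {Q : Type*} [AddCommGroup Q] [Module A Q]
    [Module.Finite A (Q × A)] [Module.Projective A (Q × A)]
    (n : ℕ) (hrank : ∀ p : PrimeSpectrum A, Module.rankAtStalk (Q × A) p = n)
    (I J : Ideal A) (hcomax : I ⊔ J = ⊤)
    (hht : ringKrullDim A + 3 ≤ (n : WithBot ℕ∞) + ((idealHeight (I ⊓ J) : ℕ∞) : WithBot ℕ∞))
    (Φ Ψ : (Q × A) →ₗ[A] A)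
    (hΦ : LinearMap.range Φ = I)
    (hΨ : LinearMap.range Ψ = J) :
    ∃ Δ : (Q × A) →ₗ[A] A,
      LinearMap.range Δ = I ⊓ J ∧
      (∀ p : Q × A, Δ p - Φ p ∈ I ^ 2) ∧
      (∀ p : Q × A, Δ p - Ψ p ∈ J ^ 2) := by
  by_cases htop : I ⊓ J = ⊤
  · obtain ⟨hI, hJ⟩ := inf_eq_top_iff.1 htop
    refine ⟨Φ, by rw [htop, hΦ, hI], fun p => by simp, fun p => ?_⟩
    rw [hJ, Ideal.top_pow]
    trivial
  have hnt : Nontrivial A := by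
    by_contra h
    rw [not_nontrivial_iff_subsingleton] at h
    exact htop (Subsingleton.elim _ _)
  have hQf : Module.Finite A Q := Module.Finite.of_surjective (LinearMap.fst A Q A)
    LinearMap.fst_surjective
  have hQp : Module.Projective A Q := Module.Projective.of_split (LinearMap.inl A Q A)
    (LinearMap.fst A Q A) (by ext; simp)
  have hrk : ∀ p : PrimeSpectrum A, Module.rankAtStalk (R := A) Q p + 1 = n := by
    intro p
    rw [← hrank p, Module.rankAtStalk_prod, Pi.add_apply, Module.rankAtStalk_self, Pi.one_apply]
  obtain ⟨p0⟩ : Nonempty (PrimeSpectrum A) := inferInstance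
  obtain ⟨r, rfl⟩ : ∃ r, n = r + 1 := ⟨_, (hrk p0).symm⟩
  have hlow : ∀ p : PrimeSpectrum A, I ⊓ J ≤ p.asIdeal → idealHeight (I ⊓ J) ≤ Order.height p :=
    fun p hp => iInf₂_le p hp
  have hup : idealHeight (I ⊓ J) ≤ ((r + 1 : ℕ) : ℕ∞) := by
    by_cases hI : I = ⊤
    · have hJ : J ≠ ⊤ := fun hJ => htop (by rw [hI, hJ, inf_top_eq])
      obtain ⟨p, hp, hp2⟩ := krull_le (r + 1) hrank Ψ (by rwa [hΨ])
      rw [hΨ] at hp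
      exact (hlow p (inf_le_right.trans hp)).trans hp2
    · obtain ⟨p, hp, hp2⟩ := krull_le (r + 1) hrank Φ (by rwa [hΦ])
      rw [hΦ] at hp
      exact (hlow p (inf_le_left.trans hp)).trans hp2
  obtain ⟨h, hh⟩ := ENat.ne_top_iff_exists.1 (ne_top_of_le_ne_top (ENat.natCast_ne_top _) hup)
  rw [← hh] at hup hlow hht
  refine main_split r h (fun p => by have := hrk p; omega) (by exact_mod_cast hup) I J hcomax hlow
    (fun p => ?_) Φ Ψ hΦ hΨ
  have h1 : ((Order.height p : ℕ∞) : WithBot ℕ∞) + 3 ≤ ((r + 1 : ℕ) : WithBot ℕ∞) + ((h : ℕ∞) : WithBot ℕ∞) :=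
    le_trans (by gcongr; exact Order.height_le_krullDim p) hht
  have h2 : Order.height p + 3 ≤ ((r + 1 : ℕ) : ℕ∞) + (h : ℕ∞) := by
    have h6 : ((Order.height p + 3 : ℕ∞) : WithBot ℕ∞) ≤
        ((((r + 1 : ℕ) : ℕ∞) + (h : ℕ∞) : ℕ∞) : WithBot ℕ∞) := by
      rw [WithBot.coe_add, WithBot.coe_add]; exact h1
    exact WithBot.coe_le_coe.1 h6
  have h3 : Order.height p ≠ ⊤ := by
    intro h3
    rw [h3, top_add, top_le_iff] at h2
    exact absurd h2 (by exact_mod_cast ENat.natCast_ne_top (r + 1 + h))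
  obtain ⟨k, hk⟩ := ENat.ne_top_iff_exists.1 h3
  rw [← hk] at h2 ⊢
  have h4 : k + 3 ≤ r + 1 + h := by exact_mod_cast h2
  have h5 : k + 2 ≤ r + h := by omega
  exact_mod_cast h5
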